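/- If u : ℝⁿ → ℝ is η-strongly convex for some η > 0, then for every η̃ with 0 < η̃ < η and every ε > 0, there exists an η̃-strongly convex function v of class C^{1,1}_loc(ℝⁿ) (i.e., v ∈ C¹(ℝⁿ) with locally Lipschitz gradient) such that v ≥ u on ℝⁿ and the Lebesgue measure of {x ∈ ℝⁿ : u(x) ≠ v(x)} is less than ε. -/

import Mathlib

open MeasureTheory Metric Set Filter
open scoped ENNReal

/-- `u : ℝⁿ → ℝ` is `η`-strongly convex: `x ↦ u x - (η/2)‖x‖²` is convex. -/
def StronglyConvexWith {n : ℕ} (η : ℝ) (u : EuclideanSpace ℝ (Fin n) → ℝ) : Prop :=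
  ConvexOn ℝ Set.univ (fun x => u x - η / 2 * ‖x‖ ^ 2)

open scoped Topology NNReal RealInnerProductSpace

section

variable {E : Type*} [NormedAddCommGroup E]

/-- The points where the second differences of `u` satisfy a quadratic upper bound with constant
`m`, at scale `1 / (m + 1)`. -/
def secondDifferenceSet (u : E → ℝ) (m : ℕ) : Set E :=
  {x | ∀ h : E, ‖h‖ * (m + 1) ≤ 1 → u (x + h) + u (x - h) ≤ 2 * u x + m * ‖h‖ ^ 2}

theorem isClosed_secondDifferenceSet {u : E → ℝ} (hu : Continuous u) (m : ℕ) :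
    IsClosed (secondDifferenceSet u m) := by
  simp only [secondDifferenceSet, ofPred_forall]
  exact isClosed_iInter fun h => isClosed_iInter fun _ => isClosed_le (by fun_prop) (by fun_prop)

theorem monotone_secondDifferenceSet (u : E → ℝ) : Monotone (secondDifferenceSet u) := by
  intro m m' hm x hx h hh
  have hm' : (m : ℝ) ≤ m' := Nat.cast_le.2 hm
  have h1 := hx h ((mul_le_mul_of_nonneg_left (by linarith) (norm_nonneg h)).trans hh)
  have : (m : ℝ) * ‖h‖ ^ 2 ≤ m' * ‖h‖ ^ 2 := by gcongr
  linarith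

end

section

variable {E : Type*} [NormedAddCommGroup E] [InnerProductSpace ℝ E]

/-- A convex function on a finite-dimensional space has a subgradient at every point. -/
theorem ConvexOn.exists_subgradient [FiniteDimensional ℝ E] {f : E → ℝ}
    (hf : ConvexOn ℝ univ f) (x : E) : ∃ p : E, ∀ y, f x + ⟪p, y - x⟫ ≤ f y := by
  have hcont : Continuous f := hf.locallyLipschitz.continuous
  have hopen : IsOpen {z : E × ℝ | f z.1 < z.2} :=
    isOpen_lt (hcont.comp continuous_fst) continuous_snd
  have hconv : Convex ℝ {z : E × ℝ | f z.1 < z.2} := by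
    simpa using hf.convex_strict_epigraph
  obtain ⟨φ, hφ⟩ := geometric_hahn_banach_point_open (x := (x, f x)) hconv hopen (by simp)
  have hsplit : ∀ (y : E) (t : ℝ), φ (y, t) = φ (y, 0) + t * φ (0, 1) := by
    intro y t
    have : ((y, t) : E × ℝ) = (y, 0) + t • (0, 1) := by simp
    rw [this, map_add, map_smul, smul_eq_mul]
  have hb : 0 < φ (0, 1) := by
    have := hφ (x, f x + 1) (by simp)
    rw [hsplit x (f x), hsplit x (f x + 1)] at this
    linarith
  have hle : ∀ y, φ (x, 0) + f x * φ (0, 1) ≤ φ (y, 0) + f y * φ (0, 1) := by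
    intro y
    refine le_of_forall_pos_le_add fun e he => ?_
    have := hφ (y, f y + e / φ (0, 1)) (by simp; positivity)
    rw [hsplit x, hsplit y, add_mul, div_mul_cancel₀ _ hb.ne'] at this
    linarith
  refine ⟨(InnerProductSpace.toDual ℝ E).symm
    (-(φ (0, 1))⁻¹ • φ.comp (ContinuousLinearMap.inl ℝ E ℝ)), fun y => ?_⟩
  rw [InnerProductSpace.toDual_symm_apply]
  have hsub : φ (y - x, 0) = φ (y, 0) - φ (x, 0) := by
    rw [← map_sub]; simp
  have := hle y
  simp only [_root_.smul_apply, ContinuousLinearMap.comp_apply,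
    ContinuousLinearMap.inl_apply, hsub, smul_eq_mul]
  rw [neg_mul, ← sub_eq_add_neg, sub_le_iff_le_add, ← sub_le_iff_le_add', inv_mul_eq_div,
    le_div_iff₀ hb]
  linarith

theorem norm_le_of_forall_inner_le {p : E} {M : ℝ} (hM : 0 ≤ M)
    (h : ∀ e : E, ‖e‖ ≤ 1 → ⟪p, e⟫ ≤ M) : ‖p‖ ≤ M := by
  rcases eq_or_ne p 0 with rfl | hp
  · simpa
  · have hp' : ‖p‖ ≠ 0 := norm_ne_zero_iff.2 hp
    have := h (‖p‖⁻¹ • p) (by rw [norm_smul, norm_inv, norm_norm, inv_mul_cancel₀ hp'])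
    rwa [real_inner_smul_right, real_inner_self_eq_norm_sq, sq, ← mul_assoc,
      inv_mul_cancel₀ hp', one_mul] at this

/-- A convex function with locally bounded second differences is differentiable, with locally
Lipschitz gradient. -/
theorem contDiff_one_and_locallyLipschitz_fderiv_of_second_difference_le
    [FiniteDimensional ℝ E] {v : E → ℝ} (hv : ConvexOn ℝ univ v)
    (hsd : ∀ R : ℝ, ∃ K : ℝ, 0 ≤ K ∧ ∀ z h : E, ‖z‖ ≤ R → ‖h‖ ≤ 1 →
      v (z + h) + v (z - h) ≤ 2 * v z + K * ‖h‖ ^ 2) :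
    ContDiff ℝ 1 v ∧ LocallyLipschitz (fderiv ℝ v) := by
  choose q hq using hv.exists_subgradient
  have hup : ∀ R : ℝ, ∃ K : ℝ, 0 ≤ K ∧ ∀ z h : E, ‖z‖ ≤ R → ‖h‖ ≤ 1 →
      v (z + h) ≤ v z + ⟪q z, h⟫ + K * ‖h‖ ^ 2 := by
    intro R
    obtain ⟨K, hK, hKR⟩ := hsd R
    refine ⟨K, hK, fun z h hz hh => ?_⟩
    have h1 := hKR z h hz hh
    have h2 := hq z (z - h)
    rw [show z - h - z = -h by abel, inner_neg_right] at h2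
    linarith
  have hder : ∀ z, HasFDerivAt v (innerSL ℝ (q z)) z := by
    intro z
    obtain ⟨K, hK, hKR⟩ := hup ‖z‖
    refine HasFDerivAt.of_isLittleO ?_
    have hO : (fun y => v y - v z - (innerSL ℝ (q z)) (y - z)) =O[𝓝 z]
        fun y => ‖y - z‖ ^ 2 := by
      refine Asymptotics.IsBigO.of_bound K ?_
      filter_upwards [Metric.closedBall_mem_nhds z one_pos] with y hy
      have hy' : ‖y - z‖ ≤ 1 := by simpa [dist_eq_norm] using hy
      have h1 := hKR z (y - z) le_rfl hy'
      have h2 := hq z y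
      rw [add_sub_cancel] at h1
      rw [innerSL_apply_apply, Real.norm_eq_abs, Real.norm_eq_abs, abs_of_nonneg (by linarith),
        abs_of_nonneg (by positivity)]
      linarith
    refine hO.trans_isLittleO ?_
    have : Tendsto (fun y => ‖y - z‖) (𝓝 z) (𝓝 0) := by
      have : Continuous fun y : E => ‖y - z‖ := by fun_prop
      simpa using this.tendsto z
    have h3 := (Asymptotics.isLittleO_one_iff ℝ).2 this
    have h4 := h3.mul_isBigO (Asymptotics.isBigO_refl (fun y => ‖y - z‖) (𝓝 z))
    simp only [one_mul, ← sq] at h4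
    exact h4.of_norm_right
  have hfd : fderiv ℝ v = fun z => innerSL ℝ (q z) := funext fun z => (hder z).fderiv
  have hLip : LocallyLipschitz (fderiv ℝ v) := by
    intro z₀
    obtain ⟨K, hK, hKR⟩ := hup (‖z₀‖ + 1)
    refine ⟨⟨2 * K, by positivity⟩, Metric.ball z₀ (1 / 2),
      Metric.ball_mem_nhds _ (by norm_num), ?_⟩
    refine LipschitzOnWith.of_dist_le_mul fun x hx y hy => ?_
    rw [hfd]
    simp only [dist_eq_norm] at hx hy ⊢
    rw [← map_sub, innerSL_apply_norm]
    rw [mem_ball, dist_eq_norm] at hx hy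
    rcases eq_or_ne (q x) (q y) with h0 | h0
    · rw [h0, sub_self, norm_zero]
      exact mul_nonneg (NNReal.coe_nonneg _) (norm_nonneg _)
    have hd : 0 < ‖q x - q y‖ := norm_pos_iff.2 (sub_ne_zero.2 h0)
    have hxy : ‖x - y‖ ≤ 1 := by
      have := norm_sub_le (x - z₀) (y - z₀)
      rw [sub_sub_sub_cancel_right] at this
      linarith
    have hyR : ‖y‖ ≤ ‖z₀‖ + 1 := by
      have := norm_le_norm_add_norm_sub' y z₀
      linarith
    set w : E := (‖x - y‖ / ‖q x - q y‖) • (q x - q y) with hw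
    have hwn : ‖w‖ = ‖x - y‖ := by
      rw [hw, norm_smul, norm_div, norm_norm, norm_norm, div_mul_cancel₀ _ hd.ne']
    have h1 := hKR y w hyR (hwn.trans_le hxy)
    have h2 := hq x (y + w)
    have h4 : ⟪q x - q y, w⟫ = ‖x - y‖ * ‖q x - q y‖ := by
      rw [hw, real_inner_smul_right, real_inner_self_eq_norm_sq]
      field_simp
    have h5 : ⟪q x, y + w - x⟫ = ⟪q x, w⟫ - ⟪q x, x - y⟫ := by
      rw [← inner_sub_right]; congr 1; abel
    rw [inner_sub_left] at h4
    have h7 : ⟪q x, y - x⟫ = - ⟪q x, x - y⟫ := by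
      rw [← inner_neg_right, neg_sub]
    rw [hwn] at h1
    rw [h5] at h2
    have h9 := hKR x (y - x) (by
      have := norm_le_norm_add_norm_sub' x z₀
      linarith) (by rwa [norm_sub_rev])
    rw [add_sub_cancel, norm_sub_rev y x, h7] at h9
    have h10 : ‖x - y‖ * ‖q x - q y‖ ≤ ‖x - y‖ * (2 * K * ‖x - y‖) := by
      have e : ‖x - y‖ * (2 * K * ‖x - y‖) = 2 * K * ‖x - y‖ ^ 2 := by ring
      rw [e]
      linarith
    rcases (norm_nonneg (x - y)).eq_or_lt' with h11 | h11
    · exact absurd (congrArg q (sub_eq_zero.1 (norm_eq_zero.1 h11))) h0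
    · exact le_of_mul_le_mul_left h10 h11
  refine ⟨contDiff_one_iff_fderiv.2 ⟨fun z => (hder z).differentiableAt, hLip.continuous⟩, hLip⟩

/-- A `C²` function satisfies a first-order Taylor estimate, locally uniformly. -/
theorem ContDiff.exists_forall_abs_sub_sub_fderiv_le [FiniteDimensional ℝ E] {Φ : E → ℝ}
    (hΦ : ContDiff ℝ 2 Φ) (R : ℝ) : ∃ K : ℝ, 0 ≤ K ∧ ∀ x y : E, ‖x‖ ≤ R → ‖y - x‖ ≤ 1 →
      |Φ y - Φ x - fderiv ℝ Φ x (y - x)| ≤ K * ‖y - x‖ ^ 2 := by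
  have h1 : ContDiff ℝ 1 (fderiv ℝ Φ) := hΦ.fderiv_right (by norm_num)
  obtain ⟨K, hK⟩ := h1.contDiffOn.exists_lipschitzOnWith one_ne_zero
    (convex_closedBall (0 : E) (R + 1)) (isCompact_closedBall _ _)
  refine ⟨K, K.coe_nonneg, fun x y hx hxy => ?_⟩
  have hsub : ∀ w ∈ closedBall x ‖y - x‖, w ∈ closedBall (0 : E) (R + 1) := by
    intro w hw
    rw [mem_closedBall, dist_eq_norm] at hw
    rw [mem_closedBall_zero_iff]
    have := norm_le_norm_add_norm_sub' w x
    linarith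
  have := (convex_closedBall x ‖y - x‖).norm_image_sub_le_of_norm_fderiv_le' (𝕜 := ℝ)
    (f := Φ) (φ := fderiv ℝ Φ x) (C := K * ‖y - x‖)
    (fun w _ => (hΦ.differentiable (by norm_num)) w) (fun w hw => ?_)
    (mem_closedBall_self (norm_nonneg _)) (by simp [dist_eq_norm] : y ∈ _)
  · rwa [Real.norm_eq_abs, mul_assoc, ← sq] at this
  · have h2 := hK.dist_le_mul w (hsub w hw) x (hsub x (mem_closedBall_self (norm_nonneg _)))
    rw [dist_eq_norm, dist_eq_norm] at h2
    rw [mem_closedBall, dist_eq_norm] at hw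
    exact h2.trans (mul_le_mul_of_nonneg_left hw K.coe_nonneg)

/-- A locally bounded function lies below a smooth function. -/
theorem Continuous.exists_contDiff_ge [FiniteDimensional ℝ E] {u : E → ℝ} (hu : Continuous u) :
    ∃ Φ : E → ℝ, ContDiff ℝ 2 Φ ∧ ∀ x, u x ≤ Φ x := by
  obtain ⟨g, hg⟩ := exists_contMDiffMap_forall_mem_convex_of_local_const (n := 2)
    (modelWithCornersSelf ℝ E) (t := fun x => Ici (u x)) (fun x => convex_Ici _) fun x =>
      ⟨u x + 1, (hu.tendsto x).eventually (Iic_mem_nhds (lt_add_one (u x)))⟩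
  exact ⟨g, g.contMDiff.contDiff, hg⟩

theorem Continuous.exists_forall_abs_le_of_norm_le [FiniteDimensional ℝ E] {f : E → ℝ}
    (hf : Continuous f) (R : ℝ) : ∃ M : ℝ, 0 ≤ M ∧ ∀ x, ‖x‖ ≤ R → |f x| ≤ M := by
  obtain ⟨M, hM⟩ := (isCompact_closedBall (0 : E) R).exists_bound_of_continuousOn hf.continuousOn
  exact ⟨max M 0, le_max_right _ _,
    fun x hx => (hM x (mem_closedBall_zero_iff.2 hx)).trans (le_max_left _ _)⟩

/-- Every selection of the subdifferential is continuous at a point of differentiability. -/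
theorem DifferentiableAt.continuousAt_subgradient [FiniteDimensional ℝ E] {u : E → ℝ} {p : E → E}
    (hp : ∀ x y, u x + ⟪p x, y - x⟫ ≤ u y) {x : E} (hx : DifferentiableAt ℝ u x) :
    ContinuousAt p x := by
  set l : E := (InnerProductSpace.toDual ℝ E).symm (fderiv ℝ u x) with hl
  have hlx : ∀ w, fderiv ℝ u x w = ⟪l, w⟫ := fun w => by
    rw [hl, InnerProductSpace.toDual_symm_apply]
  have key : Tendsto p (𝓝 x) (𝓝 l) := by
    rw [Metric.tendsto_nhds]
    intro ε hε
    have h1 := (hasFDerivAt_iff_isLittleO.1 hx.hasFDerivAt).def (c := ε / 4) (by positivity)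
    obtain ⟨r, hr, hball⟩ := Metric.eventually_nhds_iff.1 h1
    filter_upwards [Metric.ball_mem_nhds x (half_pos hr)] with y hy
    rw [mem_ball, dist_eq_norm] at hy
    suffices h : ‖p y - l‖ ≤ 3 * (ε / 4) by rw [dist_eq_norm]; linarith
    refine norm_le_of_forall_inner_le (by positivity) fun e he => ?_
    set s : ℝ := r / 4 + ‖y - x‖ / 2 with hs
    have hs0 : 0 < s := by positivity
    have hs1 : ‖y - x‖ ≤ s := by rw [hs]; linarith
    have hs2 : 2 * s < r := by rw [hs]; linarith
    have hse : ‖s • e‖ ≤ s := by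
      rw [norm_smul, Real.norm_eq_abs, _root_.abs_of_pos hs0]
      exact mul_le_of_le_one_right hs0.le he
    have hn : ‖y + s • e - x‖ ≤ 2 * s := by
      have := norm_add_le (y - x) (s • e)
      rw [show y + s • e - x = y - x + s • e by abel]
      linarith
    have h2 := hball (y := y) (by rw [dist_eq_norm]; linarith)
    have h3 := hball (y := y + s • e) (by rw [dist_eq_norm]; linarith)
    have h4 := hp y (y + s • e)
    rw [Real.norm_eq_abs, hlx, abs_le] at h2 h3
    rw [add_sub_cancel_left, real_inner_smul_right] at h4
    have h5 : ⟪l, y + s • e - x⟫ = ⟪l, y - x⟫ + s * ⟪l, e⟫ := by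
      rw [← real_inner_smul_right, ← inner_add_right]; congr 1; abel
    rw [inner_sub_left]
    have h6 : ε / 4 * ‖y + s • e - x‖ ≤ ε / 4 * (2 * s) := by gcongr
    have h7 : ε / 4 * ‖y - x‖ ≤ ε / 4 * s := by gcongr
    refine le_of_mul_le_mul_left ?_ hs0
    rw [h5] at h3
    linarith [h2.1, h3.2]
  have : p x = l := tendsto_nhds_unique (tendsto_pure_nhds p x) (key.mono_left (pure_le_nhds x))
  rwa [← this] at key

/-- The convex envelope of a function which lies above a strongly convex function and has locally
bounded second differences has locally bounded second differences. -/
theorem exists_convexOn_between_of_second_difference_le [FiniteDimensional ℝ E]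
    {u g Φ : E → ℝ} {p : E → E} {δ : ℝ} (hδ : 0 < δ)
    (hp : ∀ x y, u x + ⟪p x, y - x⟫ + δ / 2 * ‖y - x‖ ^ 2 ≤ u y)
    (hu : Continuous u) (hΦ : Continuous Φ) (hug : ∀ x, u x ≤ g x) (hgΦ : ∀ x, g x ≤ Φ x)
    (hg : ∀ R : ℝ, ∃ K : ℝ, 0 ≤ K ∧ ∀ z h : E, ‖z‖ ≤ R → ‖h‖ ≤ 1 →
      g (z + h) + g (z - h) ≤ 2 * g z + K * ‖h‖ ^ 2) :
    ∃ v : E → ℝ, ConvexOn ℝ univ v ∧ (∀ x, u x ≤ v x) ∧ (∀ x, v x ≤ g x) ∧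
      ∀ R : ℝ, ∃ K : ℝ, 0 ≤ K ∧ ∀ z h : E, ‖z‖ ≤ R → ‖h‖ ≤ 1 →
        v (z + h) + v (z - h) ≤ 2 * v z + K * ‖h‖ ^ 2 := by
  set L : Set (E × ℝ) := {l | ∀ y, ⟪l.1, y⟫ + l.2 ≤ g y}
  set v : E → ℝ := fun z => ⨆ l : L, (⟪l.1.1, z⟫ + l.1.2)
  have hmem : ∀ x, (p x, u x - ⟪p x, x⟫) ∈ L := by
    intro x y
    have h1 := hp x y
    have h2 : 0 ≤ δ / 2 * ‖y - x‖ ^ 2 := by positivity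
    rw [inner_sub_right] at h1
    have := hug y
    dsimp only
    linarith
  have : Nonempty L := ⟨⟨_, hmem 0⟩⟩
  have hbdd : ∀ z, BddAbove (range fun l : L => ⟪l.1.1, z⟫ + l.1.2) := fun z =>
    ⟨g z, by rintro _ ⟨l, rfl⟩; exact l.2 z⟩
  have hle : ∀ l ∈ L, ∀ z, ⟪l.1, z⟫ + l.2 ≤ v z := fun l hl z => le_ciSup (hbdd z) ⟨l, hl⟩
  have huv : ∀ x, u x ≤ v x := fun x => by
    have := hle _ (hmem x) x
    dsimp only at this
    linarith
  have hvg : ∀ x, v x ≤ g x := fun x => ciSup_le fun l => l.2 x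
  refine ⟨v, ⟨convex_univ, fun x _ y _ a b ha hb hab => ciSup_le fun l => ?_⟩, huv, hvg, fun R => ?_⟩
  · have h1 := mul_le_mul_of_nonneg_left (hle l l.2 x) ha
    have h2 := mul_le_mul_of_nonneg_left (hle l l.2 y) hb
    rw [inner_add_right, real_inner_smul_right, real_inner_smul_right, smul_eq_mul, smul_eq_mul]
    have h3 : l.1.2 = a * l.1.2 + b * l.1.2 := by rw [← add_mul, hab, one_mul]
    linarith
  obtain ⟨A, hA0, hA⟩ := hΦ.exists_forall_abs_le_of_norm_le (R + 2)
  obtain ⟨B, hB0, hB⟩ := hu.exists_forall_abs_le_of_norm_le (R + 1)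
  set M : ℝ := A + B + 1
  have hM0 : 0 ≤ M := by positivity
  have hslope : ∀ l ∈ L, ∀ w, ‖w‖ ≤ R + 1 → v w - 1 < ⟪l.1, w⟫ + l.2 → ‖l.1‖ ≤ M := by
    intro l hl w hw hlw
    refine norm_le_of_forall_inner_le hM0 fun e he => ?_
    have h1 := (hl (w + e)).trans (hgΦ _)
    have h2 := (abs_le.1 (hA (w + e) (by have := norm_add_le w e; linarith))).2
    have h3 := (abs_le.1 (hB w hw)).1
    have h4 := huv w
    rw [inner_add_right] at h1
    linarith
  set T : ℝ := |u 0| + ‖p 0‖ + A + M + M * |R| with hT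
  set R' : ℝ := max 1 (2 / δ * T)
  obtain ⟨K, hK0, hK⟩ := hg R'
  have hfar : ∀ y, R' ≤ ‖y‖ → A + M * (‖y‖ + R) ≤ u y := by
    intro y hy
    have h1 : 1 ≤ ‖y‖ := (le_max_left _ _).trans hy
    have h2 : 2 / δ * T ≤ ‖y‖ := (le_max_right _ _).trans hy
    have h3 : T ≤ δ / 2 * ‖y‖ := by
      have := mul_le_mul_of_nonneg_left h2 (half_pos hδ).le
      rwa [← mul_assoc, show δ / 2 * (2 / δ) = 1 by field_simp, one_mul] at this
    have h4 := hp 0 y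
    rw [sub_zero] at h4
    have h5 := (abs_le.1 (abs_real_inner_le_norm (p 0) y)).1
    have h6 := neg_abs_le (u 0)
    have h7 : T * ‖y‖ ≤ δ / 2 * ‖y‖ ^ 2 := by
      rw [sq, ← mul_assoc]; exact mul_le_mul_of_nonneg_right h3 (norm_nonneg y)
    have h8 : |u 0| * 1 ≤ |u 0| * ‖y‖ := by gcongr
    have h9 : A * 1 ≤ A * ‖y‖ := by gcongr
    have h10 : M * |R| * 1 ≤ M * |R| * ‖y‖ := by gcongr
    have h11 : M * R ≤ M * |R| := by gcongr; exact le_abs_self R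
    rw [hT] at h7
    linarith
  have hgrow : ∀ l ∈ L, ∀ w z y : E, ‖w‖ ≤ R + 1 → ‖z‖ ≤ R → v w - 1 < ⟪l.1, w⟫ + l.2 →
      R' ≤ ‖y‖ → ⟪l.1, w + (y - z)⟫ + l.2 ≤ g y := by
    intro l hl w z y hw hz hlw hy
    have h1 := (hl w).trans (hgΦ _)
    have h2 := (abs_le.1 (hA w (by linarith))).2
    have h3 := real_inner_le_norm l.1 (y - z)
    have h4 : ‖l.1‖ * ‖y - z‖ ≤ M * (‖y‖ + R) := by
      have := norm_sub_le y z
      have := hslope l hl w hw hlw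
      gcongr
      linarith
    have h5 := hfar y hy
    have h6 := hug y
    rw [inner_add_right]
    linarith
  refine ⟨K, hK0, fun z h hz hh => le_of_forall_pos_lt_add fun τ hτ => ?_⟩
  have hs : 0 < min (τ / 2) 1 := by positivity
  have hzp : ‖z + h‖ ≤ R + 1 := (norm_add_le _ _).trans (by linarith)
  have hzm : ‖z - h‖ ≤ R + 1 := (norm_sub_le _ _).trans (by linarith)
  obtain ⟨l₁, hl₁⟩ := exists_lt_of_lt_ciSup
    (show v (z + h) - min (τ / 2) 1 < ⨆ l : L, (⟪l.1.1, z + h⟫ + l.1.2) from sub_lt_self _ hs)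
  obtain ⟨l₂, hl₂⟩ := exists_lt_of_lt_ciSup
    (show v (z - h) - min (τ / 2) 1 < ⨆ l : L, (⟪l.1.1, z - h⟫ + l.1.2) from sub_lt_self _ hs)
  have ht1 := min_le_left (τ / 2) 1
  have ht2 := min_le_right (τ / 2) 1
  have hnew : ((1 / 2 : ℝ) • (l₁.1.1 + l₂.1.1),
      (⟪l₁.1.1, h⟫ - ⟪l₂.1.1, h⟫ + l₁.1.2 + l₂.1.2) / 2 - K * ‖h‖ ^ 2 / 2) ∈ L := by
    intro y
    dsimp only
    rw [real_inner_smul_left, inner_add_left]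
    rcases le_total ‖y‖ R' with hy | hy
    · have h1 := l₁.2 (y + h)
      have h2 := l₂.2 (y - h)
      have h3 := hK y h hy hh
      rw [inner_add_right] at h1
      rw [inner_sub_right] at h2
      linarith
    · have h1 := hgrow l₁ l₁.2 (z + h) z y hzp hz (by linarith) hy
      have h2 := hgrow l₂ l₂.2 (z - h) z y hzm hz (by linarith) hy
      rw [show z + h + (y - z) = y + h by abel, inner_add_right] at h1
      rw [show z - h + (y - z) = y - h by abel, inner_sub_right] at h2
      have h3 : 0 ≤ K * ‖h‖ ^ 2 := by positivity
      linarith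
  have hz' := hle _ hnew z
  dsimp only at hz'
  rw [real_inner_smul_left, inner_add_left] at hz'
  rw [inner_add_right] at hl₁
  rw [inner_sub_right] at hl₂
  linarith

/-- The gap between `u` and a `C²` function above it dominates the first-order gap at every point
of a second-difference set up to a quadratic error, uniformly on bounded sets. -/
theorem exists_quadratic_correction [FiniteDimensional ℝ E] {u Φ : E → ℝ} {p : E → E}
    (hp : ∀ x y, u x + ⟪p x, y - x⟫ ≤ u y) (hu : Continuous u) (hΦ : ContDiff ℝ 2 Φ)
    (huΦ : ∀ x, u x ≤ Φ x) (R : ℝ) (m : ℕ) :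
    ∃ D : ℝ, 0 ≤ D ∧ ∀ x ∈ secondDifferenceSet u m, ‖x‖ ≤ R → ∀ y,
      u y ≤ Φ y - (Φ x - u x) - (fderiv ℝ Φ x (y - x) - ⟪p x, y - x⟫) + D * ‖y - x‖ ^ 2 ∧
      (1 ≤ ‖y - x‖ →
        Φ y ≤ Φ y - (Φ x - u x) - (fderiv ℝ Φ x (y - x) - ⟪p x, y - x⟫) + D * ‖y - x‖ ^ 2) := by
  obtain ⟨K, hK0, hK⟩ := hΦ.exists_forall_abs_sub_sub_fderiv_le R
  obtain ⟨a₁, ha₁0, ha₁⟩ := hΦ.continuous.exists_forall_abs_le_of_norm_le R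
  obtain ⟨a₂, ha₂0, ha₂⟩ := hu.exists_forall_abs_le_of_norm_le (R + 1)
  obtain ⟨b, hb0, hb⟩ :=
    (hΦ.continuous_fderiv (by norm_num)).norm.exists_forall_abs_le_of_norm_le R
  set a := a₁ + a₂ with ha
  set c := b + (a₂ + a₂) with hc
  have ha0 : 0 ≤ a := by positivity
  have hc0 : 0 ≤ c := by positivity
  refine ⟨K + m + a * (m + 1) ^ 2 + c * (m + 1), by positivity, fun x hx hxR y => ?_⟩
  have hgap : Φ x - u x ≤ a := by
    have h1 := (abs_le.1 (ha₁ x hxR)).2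
    have h2 := (abs_le.1 (ha₂ x (by linarith))).1
    linarith
  have hpx : ‖p x‖ ≤ a₂ + a₂ := by
    refine norm_le_of_forall_inner_le (by positivity) fun e he => ?_
    have h1 := hp x (x + e)
    rw [add_sub_cancel_left] at h1
    have h2 := (abs_le.1 (ha₂ x (by linarith))).1
    have h3 := (abs_le.1 (ha₂ (x + e) ((norm_add_le _ _).trans (by linarith)))).2
    linarith
  have hlin : fderiv ℝ Φ x (y - x) - ⟪p x, y - x⟫ ≤ c * ‖y - x‖ := by
    have h1 := le_of_abs_le ((fderiv ℝ Φ x).le_opNorm (y - x))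
    have h2 : ‖fderiv ℝ Φ x‖ ≤ b := le_of_abs_le (hb x hxR)
    have h3 := (abs_le.1 (abs_real_inner_le_norm (p x) (y - x))).1
    have h4 : ‖fderiv ℝ Φ x‖ * ‖y - x‖ ≤ b * ‖y - x‖ := by gcongr
    have h5 : ‖p x‖ * ‖y - x‖ ≤ (a₂ + a₂) * ‖y - x‖ := by gcongr
    rw [hc, add_mul]
    linarith
  have hm : (1 : ℝ) ≤ m + 1 := by simp
  set t := ‖y - x‖ with ht
  have ht0 : 0 ≤ t := norm_nonneg _
  have e1 : 0 ≤ K * t ^ 2 := by positivity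
  have e2 : 0 ≤ (m : ℝ) * t ^ 2 := by positivity
  have e3 : 0 ≤ a * (m + 1) ^ 2 * t ^ 2 := by positivity
  have e4 : 0 ≤ c * (m + 1) * t ^ 2 := by positivity
  have hbig : 1 ≤ t * (m + 1) → Φ y ≤ Φ y - (Φ x - u x) -
      (fderiv ℝ Φ x (y - x) - ⟪p x, y - x⟫) + (K + m + a * (m + 1) ^ 2 + c * (m + 1)) * t ^ 2 := by
    intro h
    have h1 : a * 1 ≤ a * (t * (m + 1)) ^ 2 := by gcongr; exact one_le_pow₀ h
    have h2 : c * t * 1 ≤ c * t * (t * (m + 1)) := by gcongr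
    linarith
  refine ⟨?_, fun h => hbig (h.trans (le_mul_of_one_le_right ht0 hm))⟩
  rcases le_total (t * (m + 1)) 1 with h | h
  · have h1 := hx (y - x) h
    rw [add_sub_cancel] at h1
    have h2 := hp x (x - (y - x))
    rw [sub_sub_cancel_left, inner_neg_right] at h2
    have h3 := (abs_le.1 (hK x y hxR ((le_mul_of_one_le_right ht0 hm).trans h))).1
    rw [← ht] at h1 h3
    linarith
  · exact (huΦ y).trans (hbig h)

/-- A continuous strongly convex function lies below a function with locally bounded second
differences which agrees with it on given second-difference sets. -/
theorem exists_ge_of_second_difference_le [FiniteDimensional ℝ E] {u : E → ℝ} {p : E → E}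
    (hp : ∀ x y, u x + ⟪p x, y - x⟫ ≤ u y) (hu : Continuous u) (m : ℕ → ℕ) :
    ∃ g Φ : E → ℝ, Continuous Φ ∧ (∀ x, u x ≤ g x) ∧ (∀ x, g x ≤ Φ x) ∧
      (∀ x ∈ secondDifferenceSet u (m ⌊‖x‖⌋₊), g x ≤ u x) ∧
      ∀ R : ℝ, ∃ K : ℝ, 0 ≤ K ∧ ∀ z h : E, ‖z‖ ≤ R → ‖h‖ ≤ 1 →
        g (z + h) + g (z - h) ≤ 2 * g z + K * ‖h‖ ^ 2 := by
  obtain ⟨Φ, hΦ, huΦ⟩ := hu.exists_contDiff_ge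
  choose D hD0 hD using fun k : ℕ => exists_quadratic_correction hp hu hΦ huΦ (k + 1) (m k)
  set G : Set E := {x | x ∈ secondDifferenceSet u (m ⌊‖x‖⌋₊)}
  set φ : E → E → ℝ := fun x y => Φ y - (Φ x - u x) - (fderiv ℝ Φ x (y - x) - ⟪p x, y - x⟫) +
    D ⌊‖x‖⌋₊ * ‖y - x‖ ^ 2 with hφ
  have hφG : ∀ x ∈ G, ∀ y, u y ≤ φ x y ∧ (1 ≤ ‖y - x‖ → Φ y ≤ φ x y) := fun x hx y =>
    hD _ x hx (Nat.lt_floor_add_one _).le y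
  set ψ : Option G → E → ℝ := fun i => i.elim Φ fun x => φ x with hψ
  have huψ : ∀ i y, u y ≤ ψ i y := by
    rintro (_ | x) y
    · exact huΦ y
    · exact (hφG x x.2 y).1
  have hbdd : ∀ y, BddBelow (range fun i => ψ i y) := fun y =>
    ⟨u y, by rintro _ ⟨i, rfl⟩; exact huψ i y⟩
  refine ⟨fun y => ⨅ i, ψ i y, Φ, hΦ.continuous, fun y => le_ciInf fun i => huψ i y,
    fun y => ciInf_le (hbdd y) none, fun x hx => ?_, fun R => ?_⟩
  · refine (ciInf_le (hbdd x) (some ⟨x, hx⟩)).trans_eq ?_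
    simp [hψ, hφ]
  obtain ⟨K, hK0, hK⟩ := hΦ.exists_forall_abs_sub_sub_fderiv_le R
  set S : ℝ := ∑ k ∈ Finset.range (⌊R + 1⌋₊ + 1), D k
  have hS0 : 0 ≤ S := Finset.sum_nonneg fun k _ => hD0 k
  have hsdΦ : ∀ z h : E, ‖z‖ ≤ R → ‖h‖ ≤ 1 → Φ (z + h) + Φ (z - h) ≤ 2 * Φ z + 2 * K * ‖h‖ ^ 2 := by
    intro z h hz hh
    have h1 := (abs_le.1 (hK z (z + h) hz (by simpa using hh))).2
    have h2 := (abs_le.1 (hK z (z - h) hz (by simpa using hh))).2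
    rw [add_sub_cancel_left] at h1
    rw [sub_sub_cancel_left, map_neg, norm_neg] at h2
    linarith
  refine ⟨2 * K + 2 * S, by positivity, fun z h hz hh => ?_⟩
  have hnone : ∀ i, Φ z ≤ ψ i z →
      (⨅ i, ψ i (z + h)) + (⨅ i, ψ i (z - h)) ≤ 2 * ψ i z + (2 * K + 2 * S) * ‖h‖ ^ 2 := by
    intro i hi
    have h1 : (⨅ i, ψ i (z + h)) ≤ Φ (z + h) := ciInf_le (hbdd _) none
    have h2 : (⨅ i, ψ i (z - h)) ≤ Φ (z - h) := ciInf_le (hbdd _) none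
    have h3 := hsdΦ z h hz hh
    have h4 : 0 ≤ 2 * S * ‖h‖ ^ 2 := by positivity
    linarith
  suffices H : ∀ i, ((⨅ i, ψ i (z + h)) + (⨅ i, ψ i (z - h)) -
      (2 * K + 2 * S) * ‖h‖ ^ 2) / 2 ≤ ψ i z by
    have := le_ciInf H
    linarith
  intro i
  suffices H : (⨅ i, ψ i (z + h)) + (⨅ i, ψ i (z - h)) ≤
      2 * ψ i z + (2 * K + 2 * S) * ‖h‖ ^ 2 by linarith
  rcases i with _ | x
  · exact hnone none le_rfl
  rcases le_total 1 ‖z - x‖ with hzx | hzx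
  · exact hnone (some x) ((hφG x x.2 z).2 hzx)
  · have h1 : (⨅ i, ψ i (z + h)) ≤ φ x (z + h) := ciInf_le (hbdd _) (some x)
    have h2 : (⨅ i, ψ i (z - h)) ≤ φ x (z - h) := ciInf_le (hbdd _) (some x)
    have h3 := hsdΦ z h hz hh
    have hDS : D ⌊‖(x : E)‖⌋₊ ≤ S := by
      refine Finset.single_le_sum (f := D) (fun k _ => hD0 k) (Finset.mem_range_succ_iff.2 ?_)
      refine Nat.floor_le_floor ?_
      have := norm_le_norm_add_norm_sub z (x : E)
      linarith
    have h4 : D ⌊‖(x : E)‖⌋₊ * ‖h‖ ^ 2 ≤ S * ‖h‖ ^ 2 := by gcongr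
    have h5 := parallelogram_law_with_norm ℝ (z - x) h
    change _ ≤ 2 * φ x z + _
    simp only [hφ] at h1 h2 ⊢
    rw [show z + h - x = z - x + h by abel, map_add, inner_add_right] at h1
    rw [show z - h - x = z - x - h by abel, map_sub, inner_sub_right] at h2
    have h6 : D ⌊‖(x : E)‖⌋₊ * ‖(z : E) - x + h‖ ^ 2 + D ⌊‖(x : E)‖⌋₊ * ‖(z : E) - x - h‖ ^ 2 =
        2 * (D ⌊‖(x : E)‖⌋₊ * ‖z - x‖ ^ 2) + 2 * (D ⌊‖(x : E)‖⌋₊ * ‖h‖ ^ 2) := by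
      linear_combination D ⌊‖(x : E)‖⌋₊ * h5
    linarith

variable [FiniteDimensional ℝ E] [MeasurableSpace E] [BorelSpace E]

/-- Rademacher's theorem for locally Lipschitz functions. -/
theorem LocallyLipschitz.ae_differentiableAt {u : E → ℝ} (hu : LocallyLipschitz u)
    (μ : Measure E) [μ.IsAddHaarMeasure] : ∀ᵐ x ∂μ, DifferentiableAt ℝ u x := by
  refine measure_null_of_locally_null _ fun x _ => ?_
  obtain ⟨K, t, ht, hK⟩ := hu x
  refine ⟨interior t ∩ {x | ¬ DifferentiableAt ℝ u x},
    mem_nhdsWithin.2 ⟨interior t, isOpen_interior, mem_interior_iff_mem_nhds.2 ht, subset_rfl⟩, ?_⟩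
  refine measure_mono_null ?_ (ae_iff.1 (hK.ae_differentiableWithinAt_of_mem (μ := μ)))
  rintro y ⟨hy, hd⟩ h
  exact hd ((h (interior_subset hy)).differentiableAt (mem_interior_iff_mem_nhds.1 hy))

/-- Lipschitz maps send null sets to null sets. -/
theorem LipschitzOnWith.measure_image_eq_zero {K : ℝ≥0} {f : E → E} {s : Set E}
    (hf : LipschitzOnWith K f s) (μ : Measure E) [μ.IsAddHaarMeasure] (hs : μ s = 0) :
    μ (f '' s) = 0 := by
  refine Measure.absolutelyContinuous_isAddHaarMeasure μ (μH[Module.finrank ℝ E]) ?_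
  have h0 : μH[Module.finrank ℝ E] s = 0 :=
    Measure.absolutelyContinuous_isAddHaarMeasure _ μ hs
  refine le_antisymm ((hf.hausdorffMeasure_image_le (Nat.cast_nonneg _)).trans ?_) zero_le
  rw [h0, mul_zero]

/-- A weak form of Alexandrov's theorem for strongly convex functions: almost every point admits
a quadratic upper bound on second differences. -/
theorem ae_exists_mem_secondDifferenceSet {u : E → ℝ} (hu : LocallyLipschitz u) {p : E → E} {δ : ℝ}
    (hδ : 0 < δ) (hp : ∀ x y, u x + ⟪p x, y - x⟫ + δ / 2 * ‖y - x‖ ^ 2 ≤ u y)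
    (μ : Measure E) [μ.IsAddHaarMeasure] : ∀ᵐ x ∂μ, ∃ m, x ∈ secondDifferenceSet u m := by
  have hp0 : ∀ x y, u x + ⟪p x, y - x⟫ ≤ u y := fun x y => by
    have := hp x y
    have : 0 ≤ δ / 2 * ‖y - x‖ ^ 2 := by positivity
    linarith
  have hexp : ∀ x y, δ * ‖x - y‖ ≤ ‖p x - p y‖ := by
    intro x y
    have h1 := hp x y
    have h2 := hp y x
    have h3 := real_inner_le_norm (p x - p y) (x - y)
    rw [norm_sub_rev, ← neg_sub x y, inner_neg_right] at h1
    rw [inner_sub_left] at h3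
    rcases (norm_nonneg (x - y)).eq_or_lt' with h | h
    · rw [h, mul_zero]; exact norm_nonneg _
    · refine le_of_mul_le_mul_right ?_ h
      nlinarith
  have hinj : Function.Injective p := by
    intro x y hxy
    have := hexp x y
    rw [hxy, sub_self, norm_zero] at this
    exact sub_eq_zero.1 (norm_le_zero_iff.1 (nonpos_of_mul_nonpos_right this hδ))
  set J : E → E := Function.invFun p
  have hJp : ∀ x, J (p x) = x := Function.leftInverse_invFun hinj
  have hLip : LipschitzOnWith ⟨δ⁻¹, by positivity⟩ J (range p) := by
    refine LipschitzOnWith.of_dist_le_mul ?_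
    rintro _ ⟨x, rfl⟩ _ ⟨y, rfl⟩
    rw [hJp, hJp, dist_eq_norm, dist_eq_norm]
    change ‖x - y‖ ≤ δ⁻¹ * _
    rw [inv_mul_eq_div, le_div_iff₀' hδ]
    exact hexp x y
  set N : Set E := {z | ¬ (z ∈ range p → DifferentiableWithinAt ℝ J (range p) z)}
  have hN0 : μ (J '' N) = 0 :=
    (hLip.mono fun z hz => by by_contra h; exact hz fun h' => absurd h' h).measure_image_eq_zero μ
      (ae_iff.1 hLip.ae_differentiableWithinAt_of_mem)
  set Z : Set E := {z | z ∈ range p ∧ DifferentiableWithinAt ℝ J (range p) z ∧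
    (fderivWithin ℝ J (range p) z).det = 0}
  have hZ0 : μ (J '' Z) = 0 :=
    addHaar_image_eq_zero_of_det_fderivWithin_eq_zero μ (f' := fderivWithin ℝ J (range p))
      (fun z hz => hz.2.1.hasFDerivWithinAt.mono fun w hw => hw.1) (fun z hz => hz.2.2)
  filter_upwards [hu.ae_differentiableAt μ, measure_eq_zero_iff_ae_notMem.1 hN0,
    measure_eq_zero_iff_ae_notMem.1 hZ0] with x hx hxN hxZ
  have hd : DifferentiableWithinAt ℝ J (range p) (p x) := by
    by_contra h
    exact hxN ⟨p x, fun h' => h (h' (mem_range_self x)), hJp x⟩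
  have hdet : (fderivWithin ℝ J (range p) (p x)).det ≠ 0 := fun h =>
    hxZ ⟨p x, ⟨mem_range_self x, hd, h⟩, hJp x⟩
  have hder := hd.hasFDerivWithinAt
  have hO := (hder.isTheta_sub (ContinuousLinearMap.toContinuousLinearEquivOfDetNeZero _
    hdet).toHomeomorph.isInducing).isBigO_symm
  have hpt : Tendsto p (𝓝 x) (𝓝[range p] (p x)) :=
    tendsto_nhdsWithin_of_tendsto_nhds_of_eventually_within _ (hx.continuousAt_subgradient hp0)
      (Eventually.of_forall mem_range_self)
  have hO' := hO.comp_tendsto hpt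
  obtain ⟨C, hC⟩ := hO'.bound
  obtain ⟨r, hr, hball⟩ := Metric.eventually_nhds_iff.1 hC
  obtain ⟨m, hm⟩ := exists_nat_gt (max (2 * C) r⁻¹)
  have hm1 : 2 * C < m := (le_max_left _ _).trans_lt hm
  have hm2 : r⁻¹ < m := (le_max_right _ _).trans_lt hm
  refine ⟨m, fun h hh => ?_⟩
  have hhr : ‖h‖ < r := by
    have h1 : 0 < r⁻¹ := inv_pos.2 hr
    have h2 : ‖h‖ * (m + 1) ≤ r * r⁻¹ := by rwa [mul_inv_cancel₀ hr.ne']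
    by_contra! h3
    have : r * r⁻¹ < ‖h‖ * (m + 1) :=
      mul_lt_mul' h3 (by linarith) h1.le (hr.trans_le h3)
    linarith
  have hb1 := hball (y := x + h) (by simpa [dist_eq_norm] using hhr)
  have hb2 := hball (y := x - h) (by simpa [dist_eq_norm] using hhr)
  simp only [Function.comp_apply, hJp, add_sub_cancel_left, sub_sub_cancel_left, norm_neg]
    at hb1 hb2
  have g1 := hp0 (x + h) x
  have g2 := hp0 (x - h) x
  rw [sub_add_cancel_left, inner_neg_right] at g1
  rw [sub_sub_cancel] at g2
  have g3 := real_inner_le_norm (p (x + h) - p (x - h)) h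
  rw [inner_sub_left] at g3
  have g4 : ‖p (x + h) - p (x - h)‖ ≤ 2 * C * ‖h‖ := by
    have := norm_sub_le (p (x + h) - p x) (p (x - h) - p x)
    rw [sub_sub_sub_cancel_right] at this
    linarith
  have g5 : ‖p (x + h) - p (x - h)‖ * ‖h‖ ≤ m * ‖h‖ * ‖h‖ := by
    refine mul_le_mul_of_nonneg_right (g4.trans ?_) (norm_nonneg h)
    gcongr
  nlinarith

/-- A subset of nearly full measure is covered by the second-difference sets with constants that
are uniform on each annulus. -/
theorem exists_measure_notMem_secondDifferenceSet_lt {u : E → ℝ} (hu : Continuous u)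
    (μ : Measure E) [μ.IsAddHaarMeasure] (h : ∀ᵐ x ∂μ, ∃ m, x ∈ secondDifferenceSet u m)
    {ε : ℝ≥0∞} (hε : ε ≠ 0) :
    ∃ m : ℕ → ℕ, μ {x | x ∉ secondDifferenceSet u (m ⌊‖x‖⌋₊)} < ε := by
  obtain ⟨e, he, hsum⟩ := ENNReal.exists_pos_sum_of_countable' hε ℕ
  have hk : ∀ k : ℕ, ∃ m : ℕ, μ (ball 0 (k + 1) \ secondDifferenceSet u m) < e k := by
    intro k
    have ht := tendsto_measure_iInter_atTop (μ := μ)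
      (s := fun m => ball 0 ((k : ℝ) + 1) \ secondDifferenceSet u m)
      (fun m => (measurableSet_ball.diff
        (isClosed_secondDifferenceSet hu m).measurableSet).nullMeasurableSet)
      (fun m m' hm => sdiff_subset_sdiff_right (monotone_secondDifferenceSet u hm))
      ⟨0, ((measure_mono sdiff_subset).trans_lt measure_ball_lt_top).ne⟩
    have h0 : μ (⋂ m, ball 0 ((k : ℝ) + 1) \ secondDifferenceSet u m) = 0 := by
      refine measure_mono_null (fun x hx => ?_) (ae_iff.1 h)
      rintro ⟨m, hm⟩
      exact (mem_iInter.1 hx m).2 hm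
    rw [h0] at ht
    exact (ht.eventually (gt_mem_nhds (he k))).exists
  choose m hm using hk
  refine ⟨m, lt_of_le_of_lt ?_ hsum⟩
  calc μ {x | x ∉ secondDifferenceSet u (m ⌊‖x‖⌋₊)}
      ≤ μ (⋃ k : ℕ, ball 0 (k + 1) \ secondDifferenceSet u (m k)) := by
        refine measure_mono fun x hx => mem_iUnion.2 ⟨⌊‖x‖⌋₊, ?_, hx⟩
        rw [mem_ball_zero_iff]
        exact Nat.lt_floor_add_one _
    _ ≤ ∑' k : ℕ, μ (ball 0 ((k : ℝ) + 1) \ secondDifferenceSet u (m k)) := measure_iUnion_le _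
    _ ≤ ∑' k, e k := ENNReal.tsum_le_tsum fun k => (hm k).le

end

/-- A strongly convex function has a subgradient with quadratic gain at every point. -/
theorem StronglyConvexWith.exists_subgradient {n : ℕ} {η : ℝ} {u : EuclideanSpace ℝ (Fin n) → ℝ}
    (hu : StronglyConvexWith η u) (x : EuclideanSpace ℝ (Fin n)) :
    ∃ p, ∀ y, u x + ⟪p, y - x⟫ + η / 2 * ‖y - x‖ ^ 2 ≤ u y := by
  obtain ⟨q, hq⟩ := ConvexOn.exists_subgradient hu x
  refine ⟨q + η • x, fun y => ?_⟩
  have h1 := hq y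
  have h2 : ‖y‖ ^ 2 = ‖x‖ ^ 2 + 2 * ⟪x, y - x⟫ + ‖y - x‖ ^ 2 := by
    rw [← norm_add_sq_real, add_sub_cancel]
  rw [inner_add_left, real_inner_smul_left]
  rw [h2] at h1
  linarith

/-- Lusin-type approximation of strongly convex functions by `C^{1,1}_loc`
strongly convex functions lying above `u`. -/
theorem strongly_convex_C11loc_lusin_approx {n : ℕ}
    (u : EuclideanSpace ℝ (Fin n) → ℝ) (η : ℝ) (hη : 0 < η)
    (hu : StronglyConvexWith η u)
    (η' : ℝ) (hη' : 0 < η') (hη'η : η' < η) (ε : ℝ) (hε : 0 < ε) :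
    ∃ v : EuclideanSpace ℝ (Fin n) → ℝ,
      ContDiff ℝ 1 v ∧ LocallyLipschitz (fderiv ℝ v) ∧
      StronglyConvexWith η' v ∧
      (∀ x, u x ≤ v x) ∧
      volume {x | u x ≠ v x} < ENNReal.ofReal ε := by
  set w : EuclideanSpace ℝ (Fin n) → ℝ := fun x => u x - η' / 2 * ‖x‖ ^ 2 with hw
  have hδ : 0 < η - η' := sub_pos.2 hη'η
  have hwsc : StronglyConvexWith (η - η') w := by
    have : (fun x => w x - (η - η') / 2 * ‖x‖ ^ 2) = fun x => u x - η / 2 * ‖x‖ ^ 2 := by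
      funext x; simp only [hw]; ring
    rwa [StronglyConvexWith, this]
  choose p hp using hwsc.exists_subgradient
  have hp0 : ∀ x y, w x + ⟪p x, y - x⟫ ≤ w y := fun x y => by
    have := hp x y
    have : 0 ≤ (η - η') / 2 * ‖y - x‖ ^ 2 := by positivity
    linarith
  have hq : ContDiff ℝ 2 fun x : EuclideanSpace ℝ (Fin n) => η' / 2 * ‖x‖ ^ 2 :=
    contDiff_const.mul (contDiff_norm_sq ℝ)
  have hwLip : LocallyLipschitz w := by
    have hconv : ConvexOn ℝ univ w := by
      have h1 : ConvexOn ℝ univ fun x : EuclideanSpace ℝ (Fin n) => (η - η') / 2 * ‖x‖ ^ 2 :=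
        ((convexOn_norm convex_univ).pow (fun _ _ => norm_nonneg _) 2).smul (half_pos hδ).le
      have h2 : w = (fun x => w x - (η - η') / 2 * ‖x‖ ^ 2) +
          fun x => (η - η') / 2 * ‖x‖ ^ 2 := by
        funext x
        simp
      rw [h2]
      exact ConvexOn.add hwsc h1
    exact hconv.locallyLipschitz
  have hwc := hwLip.continuous
  obtain ⟨m, hm⟩ := exists_measure_notMem_secondDifferenceSet_lt hwc volume
    (ae_exists_mem_secondDifferenceSet hwLip hδ hp volume) (ENNReal.ofReal_pos.2 hε).ne'
  obtain ⟨g, Φ, hΦ, hwg, hgΦ, hgw, hg⟩ := exists_ge_of_second_difference_le hp0 hwc m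
  obtain ⟨v, hv, hwv, hvg, hsd⟩ :=
    exists_convexOn_between_of_second_difference_le hδ hp hwc hΦ hwg hgΦ hg
  obtain ⟨hv1, hvL⟩ := contDiff_one_and_locallyLipschitz_fderiv_of_second_difference_le hv hsd
  refine ⟨fun x => v x + η' / 2 * ‖x‖ ^ 2, hv1.add (hq.of_le (by norm_num)), ?_, ?_, fun x => ?_,
    (measure_mono fun x hx => ?_).trans_lt hm⟩
  · have : fderiv ℝ (fun x => v x + η' / 2 * ‖x‖ ^ 2) =
        fun x => fderiv ℝ v x + fderiv ℝ (fun x => η' / 2 * ‖x‖ ^ 2) x := by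
      funext x
      exact fderiv_fun_add (hv1.differentiable one_ne_zero x)
        (hq.differentiable two_ne_zero x)
    rw [this]
    exact hvL.add (hq.fderiv_right (m := 1) (by norm_num)).locallyLipschitz
  · simpa [StronglyConvexWith] using hv
  · have := hwv x
    simp only [hw] at this
    linarith
  · intro hxG
    refine hx ?_
    have h1 := hwv x
    have h2 := (hvg x).trans (hgw x hxG)
    simp only [hw] at h1 h2
    linarith
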